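/- arXiv:2411.14455 — 3 statements merged into one kernel-verified Lean document; each statement's English description precedes it below -/
import Mathlib

section
/- Let X be a set and let Ψ be a set of test functions on X such that there exists a point x₀ ∈ X with ψ(x₀) = 0 for all ψ ∈ Ψ. Let ℰ be a complex Hilbert space and f : X → B(ℰ). Suppose there exist a complex Hilbert space K, a unital *-representation π : C_b(Ψ) → B(K), and bounded operators A ∈ B(ℰ), B : K → ℰ, C : ℰ → K, D ∈ B(K) satisfying D*D = DD* = I_K, D*C = B*, and C*C = BB* = A + A*, such that for every x ∈ X the operator I_K − Dπ(E(x)) is invertible and f(x) = A + Bπ(E(x))(I_K − Dπ(E(x)))^{-1}C. Then there exists a completely positive kernel Λ : X × X → B(C_b(Ψ), B(ℰ)) such that f(x) + f(y)* = Λ(x, y)(1 − E(x)·conj(E(y))) for all x, y ∈ X. -/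
open scoped ComplexOrder
open ContinuousLinearMap MeasureTheory

noncomputable section

/-- An operator `T` on a complex Hilbert space is positive if `0 ≤ ⟪T e, e⟫` for all `e`. -/
def IsPosOp {E : Type*} [NormedAddCommGroup E] [InnerProductSpace ℂ E]
    (T : E →L[ℂ] E) : Prop :=
  ∀ e : E, 0 ≤ (inner ℂ (T e) e : ℂ)

/-- A `B(E)`-valued positive kernel on `X`. -/
def IsPositiveKernel {X E : Type*} [NormedAddCommGroup E] [InnerProductSpace ℂ E]
    (k : X → X → E →L[ℂ] E) : Prop :=
  ∀ (n : ℕ) (x : Fin n → X) (e : Fin n → E),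
    0 ≤ ∑ i, ∑ j, (inner ℂ (k (x i) (x j) (e j)) (e i) : ℂ)

/-- `Ψ` is a set of test functions on `X`: (i) `sup_{ψ ∈ Ψ} |ψ x| < 1` for every `x`, and
(ii) for every finite `F ⊆ X` the unital algebra generated by the restrictions of the
members of `Ψ` to `F` (together with constants) is everything. -/
def IsTestFunctionFamily {X : Type*} (Ψ : Set (X → ℂ)) : Prop :=
  (∀ x : X, ∃ c : ℝ, c < 1 ∧ ∀ ψ ∈ Ψ, ‖ψ x‖ ≤ c) ∧
  (∀ F : Finset X,
    Algebra.adjoin ℂ {g : {x : X // x ∈ F} → ℂ | ∃ ψ ∈ Ψ, g = fun i => ψ i.val} = ⊤)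

/-- The collection `K_Ψ(E)` of admissible positive kernels. -/
def KPsi {X : Type*} (Ψ : Set (X → ℂ)) (E : Type*) [NormedAddCommGroup E]
    [InnerProductSpace ℂ E] : Set (X → X → E →L[ℂ] E) :=
  {k | IsPositiveKernel k ∧ ∀ ψ ∈ Ψ,
    IsPositiveKernel (fun x y => (1 - ψ x * (starRingEnd ℂ) (ψ y)) • k x y)}

/-- `f` is a `Ψ`-Herglotz-Agler class function. -/
def IsHerglotzAgler {X : Type*} (Ψ : Set (X → ℂ)) {E : Type*} [NormedAddCommGroup E]
    [InnerProductSpace ℂ E] [CompleteSpace E] (f : X → E →L[ℂ] E) : Prop :=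
  ∀ k ∈ KPsi Ψ E, IsPositiveKernel
    (fun x y => f x ∘L k x y + k x y ∘L ContinuousLinearMap.adjoint (f y))

/-- `f` belongs to the `Ψ`-Schur-Agler class. -/
def IsSchurAgler {X : Type*} (Ψ : Set (X → ℂ)) {E : Type*} [NormedAddCommGroup E]
    [InnerProductSpace ℂ E] [CompleteSpace E] (f : X → E →L[ℂ] E) : Prop :=
  ∀ k ∈ KPsi Ψ E, IsPositiveKernel
    (fun x y => k x y - f x ∘L k x y ∘L ContinuousLinearMap.adjoint (f y))

/-- A completely positive kernel `Λ : X × X → B(C_b(Ψ), B(E))`. -/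
def IsCPKernel {X : Type*} (Ψ : Set (X → ℂ)) {E : Type*} [NormedAddCommGroup E]
    [InnerProductSpace ℂ E] [CompleteSpace E]
    (Λ : X → X → (BoundedContinuousFunction (↥Ψ) ℂ →L[ℂ] (E →L[ℂ] E))) : Prop :=
  ∀ (n : ℕ) (x : Fin n → X) (T : Fin n → E →L[ℂ] E)
    (g : Fin n → BoundedContinuousFunction (↥Ψ) ℂ),
    IsPosOp (∑ i, ∑ j,
      ContinuousLinearMap.adjoint (T i) ∘L (Λ (x i) (x j) (star (g i) * g j)) ∘L T j)

theorem herglotz_R_implies_D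
    {X : Type*} (Ψ : Set (X → ℂ)) (hΨ : IsTestFunctionFamily Ψ)
    (x₀ : X) (hx₀ : ∀ ψ ∈ Ψ, ψ x₀ = 0)
    {𝓔 : Type*} [NormedAddCommGroup 𝓔] [InnerProductSpace ℂ 𝓔] [CompleteSpace 𝓔]
    (E : X → BoundedContinuousFunction (↥Ψ) ℂ)
    (hE : ∀ (x : X) (ψ : ↥Ψ), E x ψ = (ψ : X → ℂ) x)
    (f : X → 𝓔 →L[ℂ] 𝓔)
    {K : Type*} [NormedAddCommGroup K] [InnerProductSpace ℂ K] [CompleteSpace K]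
    (π : BoundedContinuousFunction (↥Ψ) ℂ →⋆ₐ[ℂ] (K →L[ℂ] K))
    (A : 𝓔 →L[ℂ] 𝓔) (B : K →L[ℂ] 𝓔) (C : 𝓔 →L[ℂ] K) (D : K →L[ℂ] K)
    (hD1 : ContinuousLinearMap.adjoint D ∘L D = 1)
    (hD2 : D ∘L ContinuousLinearMap.adjoint D = 1)
    (hDC : ContinuousLinearMap.adjoint D ∘L C = ContinuousLinearMap.adjoint B)
    (hCC : ContinuousLinearMap.adjoint C ∘L C = A + ContinuousLinearMap.adjoint A)
    (hBB : B ∘L ContinuousLinearMap.adjoint B = A + ContinuousLinearMap.adjoint A)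
    (hinv : ∀ x : X, IsUnit (1 - D ∘L π (E x)))
    (hf : ∀ x : X, f x = A + B ∘L π (E x) ∘L Ring.inverse (1 - D ∘L π (E x)) ∘L C) :
    ∃ Λ : X → X → (BoundedContinuousFunction (↥Ψ) ℂ →L[ℂ] (𝓔 →L[ℂ] 𝓔)),
      IsCPKernel Ψ Λ ∧
      ∀ x y : X, f x + ContinuousLinearMap.adjoint (f y)
        = Λ x y (1 - E x * star (E y)) := by
  -- `R x = (1 - D π(E x))⁻¹` and `G x = D* R(x)* C`
  let R : X → K →L[ℂ] K := fun x => Ring.inverse (1 - D ∘L π (E x))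
  let G : X → 𝓔 →L[ℂ] K := fun x => adjoint D ∘L adjoint (R x) ∘L C
  let πc : BoundedContinuousFunction (↥Ψ) ℂ →L[ℂ] (K →L[ℂ] K) :=
    LinearMap.mkContinuous (π.toAlgHom.toLinearMap) 1 (fun g => by
      rw [one_mul]
      exact NonUnitalStarAlgHom.norm_apply_le π g)
  have hπc : ∀ g, πc g = π g := fun g => rfl
  let Λ : X → X → (BoundedContinuousFunction (↥Ψ) ℂ →L[ℂ] (𝓔 →L[ℂ] 𝓔)) := fun x y =>
    (ContinuousLinearMap.compL ℂ 𝓔 K 𝓔 (adjoint (G x))) ∘L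
      ((ContinuousLinearMap.compL ℂ 𝓔 K K).flip (G y)) ∘L πc
  have hΛ : ∀ x y g, Λ x y g = adjoint (G x) ∘L π g ∘L G y := fun x y g => rfl
  refine ⟨Λ, ?_, ?_⟩
  · intro n x T g e
    have key : inner ℂ ((∑ i, ∑ j,
        adjoint (T i) ∘L (Λ (x i) (x j) (star (g i) * g j)) ∘L T j) e) e
        = inner ℂ (∑ j, π (g j) (G (x j) (T j e))) (∑ i, π (g i) (G (x i) (T i e))) := by
      simp only [_root_.sum_apply, sum_inner, inner_sum]
      refine Finset.sum_congr rfl fun j _ => Finset.sum_congr rfl fun i _ => ?_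
      rw [hΛ, map_mul, map_star, ContinuousLinearMap.star_eq_adjoint]
      simp only [ContinuousLinearMap.comp_apply, mul_apply_eq_comp,
        ContinuousLinearMap.adjoint_inner_left]
    rw [key, inner_self_eq_norm_sq_to_K]
    positivity
  · intro x y
    have hB : B = adjoint C ∘L D := by
      have := congrArg adjoint hDC
      rw [adjoint_comp, adjoint_adjoint, adjoint_adjoint] at this
      exact this.symm
    have hfR : ∀ x, f x = adjoint C ∘L R x ∘L C - adjoint A := by
      intro x
      have h1 : (1 - D * π (E x)) * R x = 1 := Ring.mul_inverse_cancel _ (hinv x)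
      have h2 : D * π (E x) * R x = R x - 1 := by
        rw [sub_mul, one_mul] at h1
        rw [← h1]; abel
      have h3 : B ∘L π (E x) ∘L R x ∘L C = adjoint C ∘L (D * π (E x) * R x) ∘L C := by
        rw [hB]; rfl
      have h4 : adjoint C ∘L (R x - 1) ∘L C
          = adjoint C ∘L R x ∘L C - adjoint C ∘L C := by
        ext v; simp
      rw [hf x]
      change A + B ∘L π (E x) ∘L R x ∘L C = _
      rw [h3, h2, h4, hCC]; abel
    have hadj : adjoint (f y) = adjoint C ∘L adjoint (R y) ∘L C - A := by
      rw [hfR y, map_sub, adjoint_adjoint, adjoint_comp, adjoint_comp, adjoint_adjoint]; rfl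
    have hR : R x * D * (1 - π (E x) * star (π (E y))) * star D * star (R y)
        = R x + star (R y) - 1 := by
      have h1 : R x * (1 - D * π (E x)) = 1 := Ring.inverse_mul_cancel _ (hinv x)
      have h2 : star (1 - D * π (E y)) * star (R y) = 1 := by
        rw [← star_mul, show R y * (1 - D * π (E y)) = 1 from
          Ring.inverse_mul_cancel _ (hinv y), star_one]
      have h3 : D * star D = 1 := hD2
      have e1 : D * (1 - π (E x) * star (π (E y))) * star D
          = star (1 - D * π (E y)) + (1 - D * π (E x))
            - (1 - D * π (E x)) * star (1 - D * π (E y)) := by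
        have : D * (1 - π (E x) * star (π (E y))) * star D
          = D * star D - D * π (E x) * (star (π (E y)) * star D) := by noncomm_ring
        rw [this, h3, star_sub, star_one, star_mul]; noncomm_ring
      calc R x * D * (1 - π (E x) * star (π (E y))) * star D * star (R y)
          = R x * (D * (1 - π (E x) * star (π (E y))) * star D) * star (R y) := by
            simp only [mul_assoc]
        _ = R x * (star (1 - D * π (E y)) * star (R y))
            + (R x * (1 - D * π (E x))) * star (R y)
            - (R x * (1 - D * π (E x))) * (star (1 - D * π (E y)) * star (R y)) := by
            rw [e1]; simp only [mul_add, add_mul, mul_sub, sub_mul, mul_assoc]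
        _ = _ := by rw [h1, h2]; simp
    have hL : Λ x y (1 - E x * star (E y)) = adjoint C ∘L
        (R x * D * (1 - π (E x) * star (π (E y))) * star D * star (R y)) ∘L C := by
      rw [hΛ, map_sub, map_one, map_mul, map_star]
      have : adjoint (G x) = adjoint C ∘L R x ∘L D := by
        simp only [G, adjoint_comp, adjoint_adjoint]; rfl
      rw [this]; rfl
    have h5 : adjoint C ∘L (R x + star (R y) - 1) ∘L C
        = adjoint C ∘L R x ∘L C + adjoint C ∘L adjoint (R y) ∘L C - adjoint C ∘L C := by
      rw [ContinuousLinearMap.star_eq_adjoint]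
      ext v; simp
    rw [hL, hR, h5, hadj, hfR x, hCC]; abel
end
end

section
/- Let X be a set, Ψ a set of test functions on X, and ℰ a complex Hilbert space. Let f : X → B(ℰ) be such that I + f(x) is invertible for every x ∈ X, and define T : X → B(ℰ) by T(x) = (I − f(x))(I + f(x))^{-1}. Then f is a Ψ-Herglotz-Agler class function if and only if T belongs to the Ψ-Schur-Agler class SA_Ψ(ℰ). -/
open scoped ComplexOrder
open ContinuousLinearMap MeasureTheory

noncomputable section

theorem IsPositiveKernel.conj_aux {X E : Type*} [NormedAddCommGroup E] [InnerProductSpace ℂ E]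
    [CompleteSpace E] {k : X → X → E →L[ℂ] E} (hk : IsPositiveKernel k) (A : X → E →L[ℂ] E) :
    IsPositiveKernel (fun x y => A x ∘L k x y ∘L ContinuousLinearMap.adjoint (A y)) := by
  intro n x e
  have h := hk n x (fun i => ContinuousLinearMap.adjoint (A (x i)) (e i))
  simpa only [ContinuousLinearMap.adjoint_inner_right, ContinuousLinearMap.comp_apply] using h

theorem KPsi_conj_aux {X E : Type*} [NormedAddCommGroup E] [InnerProductSpace ℂ E]
    [CompleteSpace E] {Ψ : Set (X → ℂ)} {k : X → X → E →L[ℂ] E} (hk : k ∈ KPsi Ψ E)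
    (A : X → E →L[ℂ] E) :
    (fun x y => A x ∘L k x y ∘L ContinuousLinearMap.adjoint (A y)) ∈ KPsi Ψ E := by
  refine ⟨hk.1.conj_aux A, fun ψ hψ => ?_⟩
  have h := (hk.2 ψ hψ).conj_aux A
  simpa only [ContinuousLinearMap.smul_comp, ContinuousLinearMap.comp_smul] using h

theorem IsPositiveKernel.smul_aux {X E : Type*} [NormedAddCommGroup E] [InnerProductSpace ℂ E]
    {k : X → X → E →L[ℂ] E} (hk : IsPositiveKernel k) {r : ℝ} (hr : 0 ≤ r) :
    IsPositiveKernel (fun x y => (r : ℂ) • k x y) := by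
  intro n x e
  have h := mul_nonneg (Complex.zero_le_real.2 hr) (hk n x e)
  simpa [Finset.mul_sum, inner_smul_left] using h

theorem herglotz_schur_cayley
    {X : Type*} (Ψ : Set (X → ℂ)) (hΨ : IsTestFunctionFamily Ψ)
    {𝓔 : Type*} [NormedAddCommGroup 𝓔] [InnerProductSpace ℂ 𝓔] [CompleteSpace 𝓔]
    (f : X → 𝓔 →L[ℂ] 𝓔) (hinv : ∀ x : X, IsUnit (1 + f x)) :
    IsHerglotzAgler Ψ f ↔
      IsSchurAgler Ψ (fun x => (1 - f x) ∘L Ring.inverse (1 + f x)) := by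
  have key : ∀ x y (k : 𝓔 →L[ℂ] 𝓔),
      (1 + f x) ∘L k ∘L ContinuousLinearMap.adjoint (1 + f y)
        - (1 - f x) ∘L k ∘L ContinuousLinearMap.adjoint (1 - f y)
      = ((2 : ℝ) : ℂ) • (f x ∘L k + k ∘L ContinuousLinearMap.adjoint (f y)) := by
    intro x y k
    simp only [← ContinuousLinearMap.star_eq_adjoint, ← ContinuousLinearMap.mul_def, star_add,
      star_sub, star_one, Complex.ofReal_ofNat, two_smul]
    noncomm_ring
  have hT : ∀ x, ((1 - f x) ∘L Ring.inverse (1 + f x)) ∘L (1 + f x) = 1 - f x := by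
    intro x
    simp only [← ContinuousLinearMap.mul_def]
    rw [mul_assoc, Ring.inverse_mul_cancel _ (hinv x), mul_one]
  constructor
  · intro h k hk
    have h1 := (h _ (KPsi_conj_aux hk (fun x => Ring.inverse (1 + f x)))).smul_aux
      (r := 2) (by norm_num)
    simp only [← key] at h1
    convert h1 using 3 with x y
    congr 1
    have e1 := Ring.mul_inverse_cancel _ (hinv x)
    have e2 := congrArg star (Ring.mul_inverse_cancel _ (hinv y))
    rw [star_mul, star_one] at e2
    simp only [← ContinuousLinearMap.star_eq_adjoint, ← ContinuousLinearMap.mul_def]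
    rw [mul_assoc, mul_assoc, e2, mul_one, ← mul_assoc, e1, one_mul]
    · simp only [← ContinuousLinearMap.star_eq_adjoint, ← ContinuousLinearMap.mul_def, star_mul,
        mul_assoc]
  · intro h k hk
    have h1 := (h _ (KPsi_conj_aux hk (fun x => 1 + f x))).smul_aux (r := 1 / 2) (by norm_num)
    convert h1 using 3 with x y
    have e : (f x ∘L k x y + k x y ∘L ContinuousLinearMap.adjoint (f y))
        = ((1 / 2 : ℝ) : ℂ) • (((2 : ℝ) : ℂ) •
          (f x ∘L k x y + k x y ∘L ContinuousLinearMap.adjoint (f y))) := by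
      rw [smul_smul]; norm_num
    rw [e, ← key]
    congr 2
    rw [← hT x, ← hT y]
    simp only [← ContinuousLinearMap.star_eq_adjoint, ← ContinuousLinearMap.mul_def, star_mul,
        mul_assoc]
end
end

section
/- Let z₁, z₂ ∈ ℂ with |z₁| < 1 and |z₂| < 1, and set s = z₁ + z₂ and p = z₁z₂. Then for every α ∈ ℂ with |α| = 1 one has 2 − αs ≠ 0 and |(2αp − s)/(2 − αs)| < 1; moreover sup_{|α| = 1} |(2αp − s)/(2 − αs)| < 1. -/
open scoped ComplexOrder
open ContinuousLinearMap MeasureTheory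

noncomputable section

lemma aux_identity (a b : ℂ) :
    Complex.normSq (2 - (a + b)) - Complex.normSq (2 * (a * b) - (a + b)) =
      2 * (1 - Complex.normSq a) * Complex.normSq (1 - b)
        + 2 * (1 - Complex.normSq b) * Complex.normSq (1 - a) := by
  simp [Complex.normSq_apply]
  ring

lemma aux_lt (a b : ℂ) (ha : ‖a‖ < 1) (hb : ‖b‖ < 1) :
    ‖2 * (a * b) - (a + b)‖ < ‖2 - (a + b)‖ := by
  have h := aux_identity a b
  simp only [Complex.normSq_eq_norm_sq] at h
  have h1 : ∀ c : ℂ, ‖c‖ < 1 → 0 < 1 - ‖c‖ ^ 2 ∧ 0 < ‖1 - c‖ ^ 2 := by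
    intro c hc
    refine ⟨by nlinarith [norm_nonneg c], ?_⟩
    have : 1 - c ≠ 0 := by
      intro h0
      rw [← sub_eq_zero.mp h0] at hc
      simp at hc
    have := norm_pos_iff.mpr this
    positivity
  obtain ⟨a1, a2⟩ := h1 a ha
  obtain ⟨b1, b2⟩ := h1 b hb
  have := mul_pos a1 b2
  have := mul_pos b1 a2
  apply lt_of_pow_lt_pow_left₀ 2 (norm_nonneg _)
  linarith

theorem symmetrized_bidisc_test_functions
    (z₁ z₂ : ℂ) (h₁ : ‖z₁‖ < 1) (h₂ : ‖z₂‖ < 1) :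
    (∀ α : ℂ, ‖α‖ = 1 →
      2 - α * (z₁ + z₂) ≠ 0 ∧
      ‖(2 * α * (z₁ * z₂) - (z₁ + z₂)) / (2 - α * (z₁ + z₂))‖ < 1) ∧
    sSup {r : ℝ | ∃ α : ℂ, ‖α‖ = 1 ∧
      r = ‖(2 * α * (z₁ * z₂) - (z₁ + z₂)) / (2 - α * (z₁ + z₂))‖} < 1 := by
  have main : ∀ α : ℂ, ‖α‖ = 1 →
      2 - α * (z₁ + z₂) ≠ 0 ∧
      ‖(2 * α * (z₁ * z₂) - (z₁ + z₂)) / (2 - α * (z₁ + z₂))‖ < 1 := by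
    intro α hα
    have h := aux_lt (α * z₁) (α * z₂) (by simpa [hα] using h₁) (by simpa [hα] using h₂)
    rw [show 2 * (α * z₁ * (α * z₂)) - (α * z₁ + α * z₂)
      = α * (2 * α * (z₁ * z₂) - (z₁ + z₂)) by ring, ← mul_add, norm_mul, hα, one_mul] at h
    have hp := lt_of_le_of_lt (norm_nonneg _) h
    refine ⟨norm_pos_iff.mp hp, ?_⟩
    rw [norm_div, div_lt_one hp]
    exact h
  refine ⟨main, ?_⟩
  set f : ℂ → ℝ := fun α =>
    ‖(2 * α * (z₁ * z₂) - (z₁ + z₂)) / (2 - α * (z₁ + z₂))‖ with hf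
  have hS : {r : ℝ | ∃ α : ℂ, ‖α‖ = 1 ∧
      r = ‖(2 * α * (z₁ * z₂) - (z₁ + z₂)) / (2 - α * (z₁ + z₂))‖}
      = f '' Metric.sphere (0 : ℂ) 1 := by
    ext r
    simp [hf, eq_comm]
  rw [hS]
  have hc : ContinuousOn f (Metric.sphere (0 : ℂ) 1) := by
    apply ContinuousOn.norm
    apply ContinuousOn.div (by fun_prop) (by fun_prop)
    intro x hx
    exact (main x (by simpa using hx)).1
  have hm := ((isCompact_sphere (0 : ℂ) 1).image_of_continuousOn hc).sSup_mem
    ⟨f 1, 1, by simp, rfl⟩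
  obtain ⟨x, hx, hxe⟩ := hm
  rw [← hxe]
  exact (main x (by simpa using hx)).2
end
end
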